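/- There exists a constant c depending only on the dimension d such that the following holds. Let V : ℝ^d → [0,1] be Lebesgue-measurable, let φ : ℝ^d → ℝ^d be continuously differentiable with compact support, let τ > 0, and for z ∈ ℤ^d let C_z = τ(z + (−1/2, 1/2]^d) and ⟨V⟩_z = τ^{−d} ∫_{C_z} V. Then ∫_{ℝ^d} V(x) |φ(x)|² dx ≥ ∑_{z ∈ ℤ^d} ⟨V⟩_z ∫_{C_z} |φ(x)|² dx − c τ (∫_{ℝ^d} |∇φ|² dx)^{1/2} (∫_{ℝ^d} |φ|² dx)^{1/2}. -/

import Mathlib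

open MeasureTheory Real

/-- The squared Frobenius norm `|∇φ|² = ∑_{j,k} (∂_j φ^{(k)})²` of the Jacobian. -/
noncomputable def gradSq {d : ℕ} (φ : (Fin d → ℝ) → (Fin d → ℝ)) (x : Fin d → ℝ) : ℝ :=
  ∑ j, ∑ k, (fderiv ℝ φ x (Pi.single j 1) k) ^ 2

/-- The lattice cell `C_z = τ (z + (-1/2, 1/2]^d)`. -/
def cell (d : ℕ) (τ : ℝ) (z : Fin d → ℤ) : Set (Fin d → ℝ) :=
  Set.univ.pi fun i => Set.Ioc (τ * ((z i : ℝ) - 1 / 2)) (τ * ((z i : ℝ) + 1 / 2))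

section Translation

variable {E : Type*} [NormedAddCommGroup E] [MeasurableSpace E] [BorelSpace E]
  {μ : Measure E} [SFinite μ] [IsFiniteMeasureOnCompacts μ]

/-- Translating a compactly supported continuous function by a continuous parameter that ranges
over a compact set gives a jointly integrable function. -/
lemma integrable_comp_add_prod_restrict {Y : Type*} [TopologicalSpace Y] [T2Space Y]
    [MeasurableSpace Y] [BorelSpace Y] [SecondCountableTopology Y] {ν : Measure Y} [SFinite ν]
    [IsFiniteMeasureOnCompacts ν] {f : E → ℝ} (hf : Continuous f) (hfc : HasCompactSupport f)
    {s : Y → E} (hs : Continuous s) {K : Set Y} (hK : IsCompact K) :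
    Integrable (fun p : E × Y => f (p.1 + s p.2)) (μ.prod (ν.restrict K)) := by
  set L : Set E := (fun p : E × Y => p.1 - s p.2) '' (tsupport f ×ˢ K) with hL
  have hLc : IsCompact L := (hfc.isCompact.prod hK).image (by fun_prop)
  have hprod : μ.prod (ν.restrict K) = (μ.prod ν).restrict (Set.univ ×ˢ K) := by
    rw [← Measure.prod_restrict, Measure.restrict_univ]
  rw [hprod]
  have hcont : Continuous fun p : E × Y => f (p.1 + s p.2) := by fun_prop
  have hint : IntegrableOn (fun p : E × Y => f (p.1 + s p.2)) (L ×ˢ K) (μ.prod ν) :=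
    hcont.continuousOn.integrableOn_compact (hLc.prod hK)
  refine hint.of_forall_sdiff_eq_zero (MeasurableSet.univ.prod hK.measurableSet) ?_
  rintro ⟨x, y⟩ ⟨⟨-, hy⟩, hxy⟩
  by_contra hne
  refine hxy ⟨⟨(x + s y, y), ⟨subset_tsupport f hne, hy⟩, ?_⟩, hy⟩
  simp

/-- An `L¹` bound for the increments of a `C¹` function under a translation. -/
lemma integral_abs_translate_sub_le [NormedSpace ℝ E] [SecondCountableTopology E]
    [μ.IsAddRightInvariant] {f D : E → ℝ} (hf : ContDiff ℝ 1 f)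
    (hD : Continuous D) (hDc : HasCompactSupport D) {h : E} {K : ℝ}
    (hfD : ∀ x, |fderiv ℝ f x h| ≤ K * D x) :
    ∫ x, |f (x + h) - f x| ∂μ ≤ K * ∫ x, D x ∂μ := by
  have hint : Integrable (fun p : E × ℝ => D (p.1 + p.2 • h))
      (μ.prod (volume.restrict (Set.Icc (0 : ℝ) 1))) :=
    integrable_comp_add_prod_restrict hD hDc (s := fun t : ℝ => t • h) (by fun_prop) isCompact_Icc
  have hpt : ∀ x, |f (x + h) - f x| ≤ K * ∫ t in Set.Icc (0 : ℝ) 1, D (x + t • h) := by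
    intro x
    have hderiv : ∀ t : ℝ,
        HasDerivAt (fun t : ℝ => f (x + t • h)) (fderiv ℝ f (x + t • h) h) t := by
      intro t
      have h1 : HasDerivAt (fun t : ℝ => x + t • h) h t := by
        simpa using ((hasDerivAt_id t).smul_const h).const_add x
      exact ((hf.differentiable one_ne_zero _).hasFDerivAt).comp_hasDerivAt t h1
    have hcont : Continuous fun t : ℝ => fderiv ℝ f (x + t • h) h :=
      ((hf.continuous_fderiv one_ne_zero).comp (by fun_prop)).clm_apply continuous_const
    have hcont' : Continuous fun t : ℝ => K * D (x + t • h) := by fun_prop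
    have hftc := intervalIntegral.integral_eq_sub_of_hasDerivAt (fun t _ => hderiv t)
      (hcont.intervalIntegrable 0 1)
    simp only [one_smul, zero_smul, add_zero] at hftc
    rw [← hftc, integral_Icc_eq_integral_Ioc, ← intervalIntegral.integral_of_le zero_le_one,
      ← intervalIntegral.integral_const_mul]
    exact intervalIntegral.norm_integral_le_of_norm_le
      (f := fun t => fderiv ℝ f (x + t • h) h) zero_le_one
      (.of_forall fun t _ => hfD (x + t • h)) (hcont'.intervalIntegrable 0 1)
  calc ∫ x, |f (x + h) - f x| ∂μ
      ≤ ∫ x, K * (∫ t in Set.Icc (0 : ℝ) 1, D (x + t • h)) ∂μ :=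
        integral_mono_of_nonneg (Filter.Eventually.of_forall fun x => abs_nonneg _)
          (hint.integral_prod_left.const_mul K) (Filter.Eventually.of_forall hpt)
    _ = K * ∫ x, D x ∂μ := by
        rw [integral_const_mul, integral_integral_swap (f := fun x (t : ℝ) => D (x + t • h)) hint]
        simp [integral_add_right_eq_self]

end Translation

section Cells

variable {d : ℕ} {τ : ℝ}

lemma measurableSet_cell (z : Fin d → ℤ) : MeasurableSet (cell d τ z) :=
  MeasurableSet.univ_pi fun _ => measurableSet_Ioc

lemma volume_real_cell (hτ : 0 < τ) (z : Fin d → ℤ) : volume.real (cell d τ z) = τ ^ d := by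
  have hside : ∀ i, τ * ((z i : ℝ) + 1 / 2) - τ * ((z i : ℝ) - 1 / 2) = τ := fun i => by ring
  simp [cell, measureReal_def, Real.volume_pi_Ioc, hside, hτ.le, -one_div]

lemma volume_cell_lt_top (z : Fin d → ℤ) : volume (cell d τ z) < ⊤ := by
  rw [cell, Real.volume_pi_Ioc]
  exact ENNReal.prod_lt_top fun _ _ => ENNReal.ofReal_lt_top

lemma mem_cell_iff (hτ : 0 < τ) {z : Fin d → ℤ} {x : Fin d → ℝ} :
    x ∈ cell d τ z ↔ ∀ i, z i = ⌈x i / τ - 1 / 2⌉ := by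
  simp only [cell, Set.mem_univ_pi, Set.mem_Ioc]
  refine forall_congr' fun i => ?_
  rw [eq_comm, Int.ceil_eq_iff, sub_le_iff_le_add, div_le_iff₀' hτ, lt_sub_iff_add_lt,
    lt_div_iff₀' hτ]
  ring_nf

lemma pairwise_disjoint_cell (hτ : 0 < τ) : Pairwise (Function.onFun Disjoint (cell d τ)) := by
  intro z w hzw
  refine Set.disjoint_left.2 fun x hz hw => hzw (funext fun i => ?_)
  rw [(mem_cell_iff hτ).1 hz i, (mem_cell_iff hτ).1 hw i]

lemma iUnion_cell (hτ : 0 < τ) : ⋃ z, cell d τ z = Set.univ :=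
  Set.eq_univ_of_forall fun x =>
    Set.mem_iUnion.2 ⟨fun i => ⌈x i / τ - 1 / 2⌉, (mem_cell_iff hτ).2 fun _ => rfl⟩

lemma hasSum_setIntegral_cell (hτ : 0 < τ) {f : (Fin d → ℝ) → ℝ} (hf : Integrable f) :
    HasSum (fun z => ∫ x in cell d τ z, f x) (∫ x, f x) := by
  simpa [iUnion_cell hτ] using hasSum_integral_iUnion (measurableSet_cell (τ := τ))
    (pairwise_disjoint_cell hτ) hf.integrableOn

lemma sub_mem_closedBall_of_mem_cell (hτ : 0 < τ) {z : Fin d → ℤ} {x y : Fin d → ℝ}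
    (hx : x ∈ cell d τ z) (hy : y ∈ cell d τ z) : y - x ∈ Metric.closedBall 0 τ := by
  rw [mem_closedBall_zero_iff, pi_norm_le_iff_of_nonneg hτ.le]
  intro i
  have hxi := hx i trivial
  have hyi := hy i trivial
  simp only [Set.mem_Ioc] at hxi hyi
  rw [Pi.sub_apply, Real.norm_eq_abs, abs_le]
  constructor <;> linarith [hxi.1, hxi.2, hyi.1, hyi.2]

/-- On a single cell, replacing `V` by its average costs at most the mean oscillation of `f`. -/
lemma cell_average_mul_sub_le (hτ : 0 < τ) {V f : (Fin d → ℝ) → ℝ} (hV : Measurable V)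
    (hV01 : ∀ x, V x ∈ Set.Icc (0 : ℝ) 1) (hf : Continuous f) (hfi : Integrable f)
    (hG : Integrable fun x => ∫ h in Metric.closedBall 0 τ, |f (x + h) - f x|)
    (z : Fin d → ℤ) :
    ((τ ^ d)⁻¹ * ∫ x in cell d τ z, V x) * (∫ x in cell d τ z, f x)
        - ∫ x in cell d τ z, V x * f x
      ≤ (τ ^ d)⁻¹ *
        ∫ x in cell d τ z, ∫ h in Metric.closedBall 0 τ, |f (x + h) - f x| := by
  have hVn : ∀ x, ‖V x‖ ≤ 1 := fun x => by
    rw [Real.norm_of_nonneg (hV01 x).1]; exact (hV01 x).2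
  have hVi : IntegrableOn V (cell d τ z) :=
    .of_bound (volume_cell_lt_top z) hV.aestronglyMeasurable 1 (.of_forall hVn)
  have hVf : IntegrableOn (fun x => V x * f x) (cell d τ z) :=
    (hfi.bdd_mul hV.aestronglyMeasurable (.of_forall hVn)).integrableOn
  have hτd : (τ ^ d) ≠ 0 := (pow_pos hτ d).ne'
  have hcalc : ((τ ^ d)⁻¹ * ∫ x in cell d τ z, V x) * (∫ x in cell d τ z, f x)
        - ∫ x in cell d τ z, V x * f x
      = (τ ^ d)⁻¹ * ∫ x in cell d τ z,
          (V x * (∫ y in cell d τ z, f y) - τ ^ d * (V x * f x)) := by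
    rw [integral_sub (hVi.mul_const _) (hVf.const_mul _), integral_mul_const, integral_const_mul]
    field_simp
  rw [hcalc]
  refine mul_le_mul_of_nonneg_left ?_ (by positivity)
  refine setIntegral_mono_on ((hVi.mul_const _).sub (hVf.const_mul _)) hG.integrableOn
    (measurableSet_cell z) fun x hx => ?_
  have hosc : (∫ y in cell d τ z, f y) - τ ^ d * f x
      ≤ ∫ h in Metric.closedBall 0 τ, |f (x + h) - f x| := by
    have hconst : IntegrableOn (fun _ => f x) (cell d τ z) :=
      integrableOn_const (volume_cell_lt_top z).ne
    have hcont : Continuous fun h => |f (x + h) - f x| := by fun_prop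
    calc (∫ y in cell d τ z, f y) - τ ^ d * f x
        = ∫ y in cell d τ z, (f y - f x) := by
          rw [integral_sub hfi.integrableOn hconst, setIntegral_const, volume_real_cell hτ,
            smul_eq_mul]
      _ ≤ ∫ y in cell d τ z, |f y - f x| :=
          integral_mono (hfi.integrableOn.sub hconst) (hfi.integrableOn.sub hconst).abs
            fun y => le_abs_self _
      _ = ∫ h in (fun h => x + h) ⁻¹' cell d τ z, |f (x + h) - f x| :=
          ((measurePreserving_add_left volume x).setIntegral_preimage_emb
            (measurableEmbedding_addLeft x) (fun y => |f y - f x|) _).symm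
      _ ≤ ∫ h in Metric.closedBall 0 τ, |f (x + h) - f x| := by
          refine setIntegral_mono_set
            (hcont.continuousOn.integrableOn_compact (isCompact_closedBall _ _))
            (.of_forall fun _ => abs_nonneg _) (LE.le.eventuallyLE fun h hh => ?_)
          simpa using sub_mem_closedBall_of_mem_cell hτ hx hh
  have hnonneg : 0 ≤ ∫ h in Metric.closedBall 0 τ, |f (x + h) - f x| :=
    integral_nonneg fun _ => abs_nonneg _
  calc V x * (∫ y in cell d τ z, f y) - τ ^ d * (V x * f x)
      = V x * ((∫ y in cell d τ z, f y) - τ ^ d * f x) := by ring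
    _ ≤ V x * ∫ h in Metric.closedBall 0 τ, |f (x + h) - f x| :=
        mul_le_mul_of_nonneg_left hosc (hV01 x).1
    _ ≤ _ := mul_le_of_le_one_left hnonneg (hV01 x).2

/-- Cell averages of a `[0,1]`-valued weight against a nonnegative `C¹` function whose directional
derivatives at scale `τ` are dominated by `K * D`. -/
lemma tsum_cell_average_mul_sub_le (hτ : 0 < τ) {V f D : (Fin d → ℝ) → ℝ} (hV : Measurable V)
    (hV01 : ∀ x, V x ∈ Set.Icc (0 : ℝ) 1) (hf : ContDiff ℝ 1 f) (hfc : HasCompactSupport f)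
    (hf0 : ∀ x, 0 ≤ f x) (hD : Continuous D) (hDc : HasCompactSupport D) {K : ℝ}
    (hfD : ∀ h ∈ Metric.closedBall (0 : Fin d → ℝ) τ, ∀ x, |fderiv ℝ f x h| ≤ K * D x) :
    (∑' z, ((τ ^ d)⁻¹ * ∫ x in cell d τ z, V x) * ∫ x in cell d τ z, f x)
      - ∫ x, V x * f x ≤ 2 ^ d * (K * ∫ x, D x) := by
  have hfi : Integrable f := hf.continuous.integrable_of_hasCompactSupport hfc
  have hVn : ∀ x, ‖V x‖ ≤ 1 := fun x => by
    rw [Real.norm_of_nonneg (hV01 x).1]; exact (hV01 x).2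
  have hVfi : Integrable fun x => V x * f x :=
    hfi.bdd_mul hV.aestronglyMeasurable (.of_forall hVn)
  set B : Set (Fin d → ℝ) := Metric.closedBall 0 τ with hB
  have hBc : IsCompact B := isCompact_closedBall _ _
  have hprod : Integrable (fun p : (Fin d → ℝ) × (Fin d → ℝ) => |f (p.1 + p.2) - f p.1|)
      (volume.prod (volume.restrict B)) := by
    have h1 := integrable_comp_add_prod_restrict (μ := volume) (ν := volume) hf.continuous hfc
      (s := id) continuous_id hBc
    have h2 := integrable_comp_add_prod_restrict (μ := volume) (ν := volume) hf.continuous hfc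
      (s := fun _ : Fin d → ℝ => 0) continuous_const hBc
    simpa using (h1.sub h2).abs
  have hG : Integrable fun x => ∫ h in B, |f (x + h) - f x| := hprod.integral_prod_left
  have hGle : ∫ x, ∫ h in B, |f (x + h) - f x| ≤ (2 * τ) ^ d * (K * ∫ x, D x) := by
    rw [integral_integral_swap (f := fun x h => |f (x + h) - f x|) hprod]
    have hle := setIntegral_mono_on (s := B) (μ := volume) hprod.integral_prod_right
      (integrableOn_const hBc.measure_lt_top.ne) hBc.measurableSet
      fun h hh => integral_abs_translate_sub_le hf hD hDc (hfD h hh)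
    refine hle.trans_eq ?_
    rw [setIntegral_const, measureReal_def, hB, Real.volume_pi_closedBall _ hτ.le,
      ENNReal.toReal_ofReal (by positivity), Fintype.card_fin, smul_eq_mul]
  have hsf := hasSum_setIntegral_cell hτ hfi
  have hsVf := hasSum_setIntegral_cell hτ hVfi
  have hsG := (hasSum_setIntegral_cell hτ hG).mul_left (τ ^ d)⁻¹
  have hfz : ∀ z, 0 ≤ ∫ x in cell d τ z, f x := fun z => integral_nonneg hf0
  have hsum : Summable fun z =>
      ((τ ^ d)⁻¹ * ∫ x in cell d τ z, V x) * ∫ x in cell d τ z, f x := by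
    refine hsf.summable.of_nonneg_of_le (fun z => mul_nonneg (mul_nonneg (by positivity)
      (integral_nonneg fun x => (hV01 x).1)) (hfz z)) fun z => ?_
    refine mul_le_of_le_one_left (hfz z) ?_
    have hle := norm_setIntegral_le_of_norm_le_const (volume_cell_lt_top (τ := τ) z)
      fun x _ => hVn x
    rw [volume_real_cell hτ, one_mul] at hle
    rw [inv_mul_le_one₀ (pow_pos hτ d)]
    exact (le_abs_self _).trans hle
  have hle := hasSum_le (cell_average_mul_sub_le hτ hV hV01 hf.continuous hfi hG)
    (hsum.hasSum.sub hsVf) hsG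
  refine hle.trans ((mul_le_mul_of_nonneg_left hGle (by positivity)).trans_eq ?_)
  rw [mul_pow]
  field_simp

end Cells

/-- Cauchy–Schwarz for continuous functions of compact support. -/
lemma integral_sqrt_mul_sqrt_le {d : ℕ} {f g : (Fin d → ℝ) → ℝ} (hf : Continuous f)
    (hfc : HasCompactSupport f) (hf0 : ∀ x, 0 ≤ f x) (hg : Continuous g)
    (hgc : HasCompactSupport g) (hg0 : ∀ x, 0 ≤ g x) :
    ∫ x, √(g x) * √(f x) ≤ √(∫ x, g x) * √(∫ x, f x) := by
  have hfs : MemLp (fun x => √(f x)) (ENNReal.ofReal 2) :=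
    (hf.sqrt).memLp_of_hasCompactSupport (hfc.comp_left Real.sqrt_zero)
  have hgs : MemLp (fun x => √(g x)) (ENNReal.ofReal 2) :=
    (hg.sqrt).memLp_of_hasCompactSupport (hgc.comp_left Real.sqrt_zero)
  have h := integral_mul_le_Lp_mul_Lq_of_nonneg Real.HolderConjugate.two_two
    (.of_forall fun x => Real.sqrt_nonneg (g x)) (.of_forall fun x => Real.sqrt_nonneg (f x))
    hgs hfs
  simpa [Real.sq_sqrt, hf0, hg0, ← Real.sqrt_eq_rpow, -one_div] using h

section GradSq

variable {d : ℕ} {φ : (Fin d → ℝ) → (Fin d → ℝ)}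

lemma gradSq_nonneg (x : Fin d → ℝ) : 0 ≤ gradSq φ x :=
  Finset.sum_nonneg fun _ _ => Finset.sum_nonneg fun _ _ => sq_nonneg _

lemma continuous_gradSq (hφ : ContDiff ℝ 1 φ) : Continuous (gradSq φ) := by
  have h := hφ.continuous_fderiv one_ne_zero
  unfold gradSq
  fun_prop

lemma hasCompactSupport_gradSq (hφ : HasCompactSupport φ) : HasCompactSupport (gradSq φ) := by
  refine (hφ.fderiv ℝ).comp_left
    (g := fun A : (Fin d → ℝ) →L[ℝ] (Fin d → ℝ) => ∑ j, ∑ k, (A (Pi.single j 1) k) ^ 2) ?_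
  simp

lemma fderiv_sum_sq (hφ : ContDiff ℝ 1 φ) (x h : Fin d → ℝ) :
    fderiv ℝ (fun x => ∑ k, (φ x k) ^ 2) x h = 2 * ∑ k, φ x k * fderiv ℝ φ x h k := by
  have hφx : ∀ k, HasFDerivAt (fun x => φ x k) ((ContinuousLinearMap.proj k).comp (fderiv ℝ φ x))
      x := hasFDerivAt_pi'.1 (hφ.differentiable one_ne_zero x).hasFDerivAt
  rw [(HasFDerivAt.fun_sum fun k _ => (hφx k).pow 2).fderiv]
  simp [Finset.mul_sum, mul_assoc]

/-- Pointwise bound for the derivative of `|φ|²` by `|∇φ| |φ|`. -/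
lemma abs_fderiv_sum_sq_le (hφ : ContDiff ℝ 1 φ) {τ : ℝ} (hτ : 0 ≤ τ) {h : Fin d → ℝ}
    (hh : ‖h‖ ≤ τ) (x : Fin d → ℝ) :
    |fderiv ℝ (fun x => ∑ k, (φ x k) ^ 2) x h|
      ≤ 2 * √d * τ * (√(gradSq φ x) * √(∑ k, (φ x k) ^ 2)) := by
  have hexp : ∑ k, φ x k * fderiv ℝ φ x h k
      = ∑ p : Fin d × Fin d, (h p.1 * φ x p.2) * fderiv ℝ φ x (Pi.single p.1 1) p.2 := by
    have hlin : fderiv ℝ φ x h = ∑ j, h j • fderiv ℝ φ x (Pi.single j 1) := by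
      conv_lhs => rw [pi_eq_sum_univ' h]
      simp [Pi.single]
    rw [Fintype.sum_prod_type_right]
    refine Finset.sum_congr rfl fun k _ => ?_
    rw [hlin, Finset.sum_apply, Finset.mul_sum]
    exact Finset.sum_congr rfl fun j _ => by rw [Pi.smul_apply, smul_eq_mul]; ring
  have hh2 : ∑ j, h j ^ 2 ≤ d * τ ^ 2 := by
    have hj : ∀ j ∈ Finset.univ, h j ^ 2 ≤ τ ^ 2 := fun j _ =>
      sq_le_sq' (by linarith [(abs_le.1 ((norm_le_pi_norm h j).trans hh)).1])
        (abs_le.1 ((norm_le_pi_norm h j).trans hh)).2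
    simpa using Finset.sum_le_card_nsmul Finset.univ _ _ hj
  have hsq : (∑ k, φ x k * fderiv ℝ φ x h k) ^ 2
      ≤ (√d * τ * (√(gradSq φ x) * √(∑ k, (φ x k) ^ 2))) ^ 2 := by
    have hf0 : 0 ≤ ∑ k, (φ x k) ^ 2 := Finset.sum_nonneg fun _ _ => sq_nonneg _
    calc (∑ k, φ x k * fderiv ℝ φ x h k) ^ 2
        ≤ (∑ p : Fin d × Fin d, (h p.1 * φ x p.2) ^ 2)
            * ∑ p : Fin d × Fin d, (fderiv ℝ φ x (Pi.single p.1 1) p.2) ^ 2 := by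
          rw [hexp]; exact Finset.sum_mul_sq_le_sq_mul_sq _ _ _
      _ = ((∑ j, h j ^ 2) * ∑ k, (φ x k) ^ 2) * gradSq φ x := by
          simp only [mul_pow, Fintype.sum_prod_type, gradSq, Finset.sum_mul_sum]
      _ ≤ ((d * τ ^ 2) * ∑ k, (φ x k) ^ 2) * gradSq φ x := by
          have := gradSq_nonneg (φ := φ) x
          gcongr
      _ = _ := by
          simp only [mul_pow, Real.sq_sqrt hf0, Real.sq_sqrt (gradSq_nonneg x),
            Real.sq_sqrt (Nat.cast_nonneg d)]
          ring
  have habs := abs_le_of_sq_le_sq hsq (by positivity)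
  rw [fderiv_sum_sq hφ, abs_mul, abs_two]
  linarith [habs]

end GradSq

/-- Lower bound for `∫ V |φ|²` through cell averages of the `[0,1]`-valued weight `V`:
`∫ V |φ|² ≥ ∑_z ⟨V⟩_z ∫_{C_z} |φ|² - c τ (∫ |∇φ|²)^{1/2} (∫ |φ|²)^{1/2}`,
with `c` depending only on `d`. -/
theorem potential_cell_average_lower_bound (d : ℕ) (hd : 1 ≤ d) :
    ∃ c : ℝ, 0 < c ∧ ∀ V : (Fin d → ℝ) → ℝ, Measurable V →
      (∀ x, V x ∈ Set.Icc (0 : ℝ) 1) →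
      ∀ φ : (Fin d → ℝ) → (Fin d → ℝ), ContDiff ℝ 1 φ → HasCompactSupport φ →
      ∀ τ : ℝ, 0 < τ →
      (∑' z : Fin d → ℤ,
          ((τ ^ d)⁻¹ * ∫ x in cell d τ z, V x) * ∫ x in cell d τ z, ∑ k, (φ x k) ^ 2)
        - c * τ * Real.sqrt (∫ x, gradSq φ x) * Real.sqrt (∫ x, ∑ k, (φ x k) ^ 2)
        ≤ ∫ x, V x * ∑ k, (φ x k) ^ 2 := by
  refine ⟨2 ^ d * (2 * √d), by positivity, fun V hV hV01 φ hφ hφc τ hτ => ?_⟩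
  have hf : ContDiff ℝ 1 fun x => ∑ k, (φ x k) ^ 2 :=
    ContDiff.sum fun k _ => (contDiff_pi.1 hφ k).pow 2
  have hfc : HasCompactSupport fun x => ∑ k, (φ x k) ^ 2 :=
    hφc.comp_left (g := fun v : Fin d → ℝ => ∑ k, (v k) ^ 2) (by simp)
  have hf0 : ∀ x, 0 ≤ ∑ k, (φ x k) ^ 2 := fun x => Finset.sum_nonneg fun _ _ => sq_nonneg _
  have hg := continuous_gradSq hφ
  have hgc := hasCompactSupport_gradSq hφc
  have hmain := tsum_cell_average_mul_sub_le hτ hV hV01 hf hfc hf0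
    (D := fun x => √(gradSq φ x) * √(∑ k, (φ x k) ^ 2)) (hg.sqrt.mul hf.continuous.sqrt)
    ((hgc.comp_left Real.sqrt_zero).mul_right) (K := 2 * √d * τ)
    fun h hh x => abs_fderiv_sum_sq_le hφ hτ.le (mem_closedBall_zero_iff.1 hh) x
  have hcs := mul_le_mul_of_nonneg_left
    (integral_sqrt_mul_sqrt_le hf.continuous hfc hf0 hg hgc gradSq_nonneg)
    (show 0 ≤ 2 ^ d * (2 * √d * τ) by positivity)
  linarith
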